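/- Let ν = (n₁,…,n_s) be a sequence of positive integers with n = n₁ + ⋯ + n_s, let I(ν) be the set of ν-block-increasing permutations of {1,…,n}, and let ν_o be the number of indices j with n_j odd. Then the signed count Σ_{w ∈ I(ν)} (−1)^{ℓ(w)}, where ℓ(w) is the inversion number of w (equivalently, the sum Σ_{w ∈ I(ν)} sign(w) of the signs of these permutations), equals 0 if ν_o ≥ 2, and equals the multinomial coefficient ⌊n/2⌋!/(⌊n₁/2⌋!⋯⌊n_s/2⌋!) if ν_o ≤ 1. -/

import Mathlib

/-- `blockStart ν j = n₁ + ⋯ + n_j` is the `j`-th partial sum of the block sizes `ν`. -/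
def blockStart (ν : ℕ → ℕ) (j : ℕ) : ℕ := ∑ i ∈ Finset.range j, ν i

/-- A permutation `w` of `{0, …, n-1}` is `ν`-block-increasing if it is strictly increasing
on each block `{blockStart ν j, …, blockStart ν (j+1) - 1}`, `0 ≤ j < s`. -/
def BlockIncreasing (s n : ℕ) (ν : ℕ → ℕ) (w : Equiv.Perm (Fin n)) : Prop :=
  ∀ j < s, ∀ t r : Fin n, blockStart ν j ≤ (t : ℕ) → (t : ℕ) < (r : ℕ) →
    (r : ℕ) < blockStart ν (j + 1) → (w t : ℕ) < (w r : ℕ)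

/-- The inversion number `ℓ(w) = #{(t,r) : t < r, w(t) > w(r)}` of a permutation `w`. -/
def inversions (n : ℕ) (w : Equiv.Perm (Fin n)) : ℕ :=
  (Finset.univ.filter fun p : Fin n × Fin n => p.1 < p.2 ∧ w p.2 < w p.1).card

open scoped Classical

/-- The number of occurrences of the letter `j` in the word `f`. -/
def letterCount {s n : ℕ} (f : Fin n → Fin s) (j : Fin s) : ℕ :=
  (Finset.univ.filter fun u => f u = j).card

/-- The inversion number of a word. -/
def wordInversions {s n : ℕ} (f : Fin n → Fin s) : ℕ :=
  (Finset.univ.filter fun p : Fin n × Fin n => p.1 < p.2 ∧ f p.2 < f p.1).card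

/-- The signed count of the words with `ν j` occurrences of each letter `j`. -/
def signedWordCount (s n : ℕ) (ν : Fin s → ℕ) : ℤ :=
  ∑ f : Fin n → Fin s, if letterCount f = ν then (-1 : ℤ) ^ wordInversions f else 0

theorem letterCount_cons {s n : ℕ} (j : Fin s) (g : Fin n → Fin s) (i : Fin s) :
    letterCount (Fin.cons j g : Fin (n + 1) → Fin s) i =
      (if j = i then 1 else 0) + letterCount g i := by
  simp only [letterCount, Finset.card_filter, Fin.sum_univ_succ, Fin.cons_zero, Fin.cons_succ]

theorem wordInversions_cons {s n : ℕ} (j : Fin s) (g : Fin n → Fin s) :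
    wordInversions (Fin.cons j g : Fin (n + 1) → Fin s) =
      ∑ i ∈ Finset.Iio j, letterCount g i + wordInversions g := by
  have h : ∑ i ∈ Finset.Iio j, letterCount g i = (Finset.univ.filter fun u => g u < j).card := by
    rw [Finset.card_eq_sum_card_fiberwise (f := g) (t := Finset.Iio j)
      (fun u hu => by simpa using hu)]
    refine Finset.sum_congr rfl fun i hi => ?_
    rw [letterCount, Finset.filter_filter]
    congr 1
    ext u
    have := Finset.mem_Iio.1 hi
    simp only [Finset.mem_filter, Finset.mem_univ, true_and]
    exact ⟨fun h => ⟨h ▸ this, h⟩, fun h => h.2⟩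
  rw [h]
  simp only [wordInversions, Finset.card_filter, Fintype.sum_prod_type, Fin.sum_univ_succ,
    Fin.cons_zero, Fin.cons_succ, Fin.succ_pos, Fin.succ_lt_succ_iff, Fin.not_lt_zero,
    true_and, false_and, if_false, zero_add]

theorem letterCount_cons_eq_iff {s n : ℕ} (j : Fin s) (g : Fin n → Fin s) (ν : Fin s → ℕ) :
    letterCount (Fin.cons j g : Fin (n + 1) → Fin s) = ν ↔
      0 < ν j ∧ letterCount g = Function.update ν j (ν j - 1) := by
  simp only [funext_iff, letterCount_cons, Function.update_apply]
  constructor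
  · intro h
    have hj := h j
    rw [if_pos rfl] at hj
    refine ⟨by omega, fun i => ?_⟩
    have hi := h i
    split_ifs with hij
    · subst hij; omega
    · rw [if_neg (Ne.symm hij)] at hi; omega
  · rintro ⟨h0, h⟩ i
    have hi := h i
    split_ifs with hij
    · subst hij; rw [if_pos rfl] at hi; omega
    · rw [if_neg (Ne.symm hij)] at hi; omega

theorem signedWordCount_succ (s n : ℕ) (ν : Fin s → ℕ) :
    signedWordCount s (n + 1) ν =
      ∑ j : Fin s, if 0 < ν j then (-1 : ℤ) ^ (∑ i ∈ Finset.Iio j, ν i) *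
        signedWordCount s n (Function.update ν j (ν j - 1)) else 0 := by
  rw [signedWordCount, ← (Fin.consEquiv fun _ : Fin (n + 1) => Fin s).sum_comp,
    Fintype.sum_prod_type]
  refine Finset.sum_congr rfl fun j _ => ?_
  change (∑ g : Fin n → Fin s, if letterCount (Fin.cons j g : Fin (n + 1) → Fin s) = ν then
    (-1 : ℤ) ^ wordInversions (Fin.cons j g : Fin (n + 1) → Fin s) else 0) = _
  by_cases h0 : 0 < ν j
  · rw [if_pos h0, signedWordCount, Finset.mul_sum]
    refine Finset.sum_congr rfl fun g _ => ?_
    by_cases hg : letterCount g = Function.update ν j (ν j - 1)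
    · rw [if_pos ((letterCount_cons_eq_iff j g ν).2 ⟨h0, hg⟩), if_pos hg, wordInversions_cons,
        pow_add]
      congr 2
      refine Finset.sum_congr rfl fun i hi => ?_
      rw [hg, Function.update_of_ne (Finset.mem_Iio.1 hi).ne]
    · rw [if_neg fun h => hg ((letterCount_cons_eq_iff j g ν).1 h).2, if_neg hg, mul_zero]
  · rw [if_neg h0]
    exact Finset.sum_eq_zero fun g _ =>
      if_neg fun h => h0 ((letterCount_cons_eq_iff j g ν).1 h).1

/-- The letters occurring an odd number of times. -/
def oddLetters {s : ℕ} (ν : Fin s → ℕ) : Finset (Fin s) := Finset.univ.filter fun j => Odd (ν j)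

theorem mem_oddLetters {s : ℕ} {ν : Fin s → ℕ} {j : Fin s} : j ∈ oddLetters ν ↔ Odd (ν j) := by
  simp [oddLetters]

theorem oddLetters_update_of_mem {s : ℕ} {ν : Fin s → ℕ} {j : Fin s} (hj : j ∈ oddLetters ν) :
    oddLetters (Function.update ν j (ν j - 1)) = (oddLetters ν).erase j := by
  ext i
  rw [mem_oddLetters] at hj
  rw [Finset.mem_erase, mem_oddLetters, mem_oddLetters, Function.update_apply]
  split_ifs with h
  · subst h
    simp only [ne_eq, not_true_eq_false, false_and, iff_false, Nat.not_odd_iff_even]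
    grind
  · simp [h]

theorem oddLetters_update_of_notMem {s : ℕ} {ν : Fin s → ℕ} {j : Fin s} (h0 : 0 < ν j)
    (hj : j ∉ oddLetters ν) :
    oddLetters (Function.update ν j (ν j - 1)) = insert j (oddLetters ν) := by
  ext i
  rw [mem_oddLetters] at hj
  rw [Finset.mem_insert, mem_oddLetters, mem_oddLetters, Function.update_apply]
  split_ifs with h
  · subst h
    simp only [true_or, iff_true]
    grind
  · simp [h]

theorem sum_update_pred {s n : ℕ} {ν : Fin s → ℕ} (hν : ∑ j, ν j = n + 1) {j : Fin s}
    (h0 : 0 < ν j) : ∑ i, Function.update ν j (ν j - 1) i = n := by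
  rw [Finset.sum_update_of_mem (Finset.mem_univ j)]
  have := Finset.add_sum_erase Finset.univ ν (Finset.mem_univ j)
  rw [Finset.erase_eq] at this
  omega

theorem prod_factorial_update_of_odd {s : ℕ} {ν : Fin s → ℕ} {j : Fin s} (hj : Odd (ν j)) :
    ∏ i, (Function.update ν j (ν j - 1) i / 2).factorial = ∏ i, (ν i / 2).factorial := by
  refine Finset.prod_congr rfl fun i _ => ?_
  rw [Function.update_apply]
  split_ifs with h
  · subst h
    congr 1
    grind
  · rfl

theorem prod_factorial_of_even {s : ℕ} {ν : Fin s → ℕ} {j : Fin s} (h0 : 0 < ν j)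
    (hj : Even (ν j)) :
    ∏ i, (ν i / 2).factorial =
      ν j / 2 * ∏ i, (Function.update ν j (ν j - 1) i / 2).factorial := by
  rw [← Finset.mul_prod_erase _ _ (Finset.mem_univ j),
    ← Finset.mul_prod_erase Finset.univ
      (fun i => (Function.update ν j (ν j - 1) i / 2).factorial) (Finset.mem_univ j), ← mul_assoc]
  congr 1
  · rw [Function.update_self]
    obtain ⟨k, hk⟩ := hj
    have h1 : ν j / 2 = (k - 1) + 1 := by omega
    have h2 : (ν j - 1) / 2 = k - 1 := by omega
    rw [h1, h2, Nat.factorial_succ]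
  · refine Finset.prod_congr rfl fun i hi => ?_
    rw [Function.update_of_ne (Finset.ne_of_mem_erase hi)]

theorem odd_sum_Iio_iff {s : ℕ} (ν : Fin s → ℕ) (j : Fin s) :
    Odd (∑ i ∈ Finset.Iio j, ν i) ↔ Odd ((oddLetters ν).filter (· < j)).card := by
  rw [Finset.odd_sum_iff_odd_card_odd]
  have : (Finset.Iio j).filter (fun i => Odd (ν i)) = (oddLetters ν).filter (· < j) := by
    ext i
    simp [oddLetters, and_comm]
  rw [this]

theorem signedWordCount_spec {s : ℕ} (n : ℕ) (ν : Fin s → ℕ) (hν : ∑ j, ν j = n) :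
    (2 ≤ (oddLetters ν).card → signedWordCount s n ν = 0) ∧
    ((oddLetters ν).card ≤ 1 →
      signedWordCount s n ν * (∏ j, (ν j / 2).factorial : ℕ) = ((n / 2).factorial : ℕ)) := by
  induction n generalizing ν with
  | zero =>
    have h0 : ν = 0 := by
      ext j
      exact Finset.sum_eq_zero_iff.1 hν j (Finset.mem_univ j)
    subst h0
    simp [oddLetters, signedWordCount, wordInversions, letterCount, funext_iff]
  | succ n ih =>
    have hcard : Even (oddLetters ν).card ↔ Even (n + 1) := by
      rw [← hν, Finset.even_sum_iff_even_card_odd]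
      rfl
    have htriple : ∀ j, 0 < ν j → j ∉ oddLetters ν → 1 ≤ (oddLetters ν).card →
        signedWordCount s n (Function.update ν j (ν j - 1)) = 0 := by
      intro j h0 hj h1
      refine (ih _ (sum_update_pred hν h0)).1 ?_
      rw [oddLetters_update_of_notMem h0 hj, Finset.card_insert_of_notMem hj]
      omega
    have hodd : ∀ j ∈ oddLetters ν, (oddLetters ν).card ≤ 2 →
        signedWordCount s n (Function.update ν j (ν j - 1)) * (∏ j, (ν j / 2).factorial : ℕ) =
          ((n / 2).factorial : ℕ) := by
      intro j hj h2
      have hj' := mem_oddLetters.1 hj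
      have := (ih _ (sum_update_pred hν hj'.pos)).2 (by
        rw [oddLetters_update_of_mem hj, Finset.card_erase_of_mem hj]
        omega)
      rwa [prod_factorial_update_of_odd hj'] at this
    rw [signedWordCount_succ]
    have hprod : ((∏ j, (ν j / 2).factorial : ℕ) : ℤ) ≠ 0 := by
      exact_mod_cast (Finset.prod_pos fun j _ => Nat.factorial_pos _).ne'
    refine ⟨fun h2 => ?_, fun h1 => ?_⟩
    · rcases h2.eq_or_lt with h2 | h3
      · obtain ⟨a, b, hab, hO⟩ : ∃ a b, a < b ∧ oddLetters ν = {a, b} := by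
          obtain ⟨a, b, hab, hO⟩ := Finset.card_eq_two.1 h2.symm
          rcases hab.lt_or_gt with h | h
          · exact ⟨a, b, h, hO⟩
          · exact ⟨b, a, h, by rw [hO, Finset.pair_comm]⟩
        have ha : a ∈ oddLetters ν := by simp [hO]
        have hb : b ∈ oddLetters ν := by simp [hO]
        have hsa : Even (∑ i ∈ Finset.Iio a, ν i) := by
          rw [← Nat.not_odd_iff_even, odd_sum_Iio_iff, hO]
          simp [Finset.filter_insert, Finset.filter_singleton, hab.not_gt]
        have hsb : Odd (∑ i ∈ Finset.Iio b, ν i) := by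
          rw [odd_sum_Iio_iff, hO]
          simp [Finset.filter_insert, Finset.filter_singleton, hab]
        rw [Finset.sum_eq_add_of_mem a b (Finset.mem_univ a) (Finset.mem_univ b) hab.ne,
          if_pos (mem_oddLetters.1 ha).pos, if_pos (mem_oddLetters.1 hb).pos,
          hsa.neg_one_pow, hsb.neg_one_pow]
        · have := mul_right_cancel₀ hprod ((hodd a ha h2.ge).trans (hodd b hb h2.ge).symm)
          rw [this]
          ring
        · intro c _ hc
          split_ifs with h0
          · rw [htriple c h0 (by simp [hO, hc]) (by omega), mul_zero]
          · rfl
      · refine Finset.sum_eq_zero fun j _ => ?_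
        split_ifs with h0
        · by_cases hj : j ∈ oddLetters ν
          · rw [(ih _ (sum_update_pred hν h0)).1, mul_zero]
            rw [oddLetters_update_of_mem hj, Finset.card_erase_of_mem hj]
            omega
          · rw [htriple j h0 hj (by omega), mul_zero]
        · rfl
    · rcases h1.eq_or_lt with h1 | h0
      · obtain ⟨a, hO⟩ := Finset.card_eq_one.1 h1
        have ha : a ∈ oddLetters ν := by simp [hO]
        have hsa : Even (∑ i ∈ Finset.Iio a, ν i) := by
          rw [← Nat.not_odd_iff_even, odd_sum_Iio_iff, hO]
          simp [Finset.filter_singleton]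
        rw [Finset.sum_eq_single_of_mem a (Finset.mem_univ a), if_pos (mem_oddLetters.1 ha).pos,
          hsa.neg_one_pow, one_mul, hodd a ha (by omega)]
        · congr 2
          rw [h1] at hcard
          grind
        · intro c _ hc
          split_ifs with h0
          · rw [htriple c h0 (by simp [hO, hc]) (by omega), mul_zero]
          · rfl
      · have hO : oddLetters ν = ∅ := Finset.card_eq_zero.1 (by omega)
        have hev : ∀ j, Even (ν j) := fun j => by
          rw [← Nat.not_odd_iff_even, ← mem_oddLetters, hO]
          exact Finset.notMem_empty j
        have hterm : ∀ j, (if 0 < ν j then (-1 : ℤ) ^ (∑ i ∈ Finset.Iio j, ν i) *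
            signedWordCount s n (Function.update ν j (ν j - 1)) else 0) *
              (∏ j, (ν j / 2).factorial : ℕ) = ((ν j / 2 : ℕ) : ℤ) * ((n / 2).factorial : ℕ) := by
          intro j
          split_ifs with hj
          · have hj' : j ∉ oddLetters ν := by simp [hO]
            rw [(Finset.even_sum _ fun i _ => hev i).neg_one_pow, one_mul,
              prod_factorial_of_even hj (hev j), ← (ih _ (sum_update_pred hν hj)).2 (by
                rw [oddLetters_update_of_notMem hj hj', hO]
                simp)]
            push_cast
            ring
          · have : ν j = 0 := by omega
            simp [this]
        rw [Finset.sum_mul, Finset.sum_congr rfl fun j _ => hterm j, ← Finset.sum_mul]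
        have hhalf : ∑ j, ν j / 2 = n / 2 + 1 := by
          have : ∑ j, ν j = 2 * ∑ j, ν j / 2 := by
            rw [Finset.mul_sum]
            exact Finset.sum_congr rfl fun j _ => (Nat.two_mul_div_two_of_even (hev j)).symm
          omega
        have hn : (n + 1) / 2 = n / 2 + 1 := by
          have : Even (n + 1) := hν ▸ Finset.even_sum _ fun i _ => hev i
          grind
        rw [← Nat.cast_sum, hhalf, hn, Nat.factorial_succ]
        push_cast
        ring

theorem blockStart_succ (ν : ℕ → ℕ) (j : ℕ) : blockStart ν (j + 1) = blockStart ν j + ν j :=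
  Finset.sum_range_succ ν j

theorem blockStart_mono (ν : ℕ → ℕ) : Monotone (blockStart ν) :=
  monotone_nat_of_le_succ fun j => by rw [blockStart_succ]; omega

theorem exists_block_mem (ν : ℕ → ℕ) (s t : ℕ) (ht : t < blockStart ν s) :
    ∃ j < s, blockStart ν j ≤ t ∧ t < blockStart ν (j + 1) := by
  induction s with
  | zero => simp [blockStart] at ht
  | succ s ih =>
    by_cases h : t < blockStart ν s
    · obtain ⟨j, hj, h⟩ := ih h
      exact ⟨j, by omega, h⟩
    · exact ⟨s, by omega, by omega, ht⟩

theorem exists_block (ν : ℕ → ℕ) (s : ℕ) :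
    ∃ b : Fin (blockStart ν s) → Fin s, ∀ t j,
      b t = j ↔ blockStart ν j ≤ t ∧ (t : ℕ) < blockStart ν (j + 1) := by
  choose b hb h using fun t : Fin (blockStart ν s) => exists_block_mem ν s t t.2
  refine ⟨fun t => ⟨b t, hb t⟩, fun t j => ⟨fun hj => hj ▸ h t, fun hj => ?_⟩⟩
  refine Fin.ext (show b t = j from ?_)
  rcases lt_trichotomy (b t) j with hlt | heq | hlt
  · have := blockStart_mono ν (Nat.succ_le_of_lt hlt)
    have := h t
    simp only [Nat.succ_eq_add_one] at *
    omega
  · exact heq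
  · have := blockStart_mono ν (Nat.succ_le_of_lt hlt)
    have := h t
    simp only [Nat.succ_eq_add_one] at *
    omega

theorem block_monotone {s : ℕ} {ν : ℕ → ℕ} {b : Fin (blockStart ν s) → Fin s}
    (hb : ∀ t j, b t = j ↔ blockStart ν j ≤ t ∧ (t : ℕ) < blockStart ν (j + 1)) : Monotone b := by
  intro t r htr
  by_contra! hlt
  have h1 := (hb t _).1 rfl
  have h2 := (hb r _).1 rfl
  have h3 : blockStart ν (b r + 1) ≤ blockStart ν (b t) := blockStart_mono ν (by omega)
  have h4 : (t : ℕ) ≤ r := htr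
  omega

theorem letterCount_block {s : ℕ} {ν : ℕ → ℕ} {b : Fin (blockStart ν s) → Fin s}
    (hb : ∀ t j, b t = j ↔ blockStart ν j ≤ t ∧ (t : ℕ) < blockStart ν (j + 1)) : letterCount b = fun j : Fin s => ν j := by
  ext j
  have hle : blockStart ν (j + 1) ≤ blockStart ν s := blockStart_mono ν j.2
  have : (Finset.univ.filter fun t => b t = j).map Fin.valEmbedding =
      Finset.Ico (blockStart ν j) (blockStart ν (j + 1)) := by
    ext t
    simp only [Finset.mem_map, Finset.mem_filter, Finset.mem_univ, true_and, hb,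
      Fin.valEmbedding_apply, Finset.mem_Ico]
    constructor
    · rintro ⟨u, hu, rfl⟩
      exact hu
    · intro h
      exact ⟨⟨t, by omega⟩, h, rfl⟩
  rw [letterCount, ← Finset.card_map Fin.valEmbedding, this, Nat.card_Ico, blockStart_succ]
  omega

theorem blockIncreasing_iff {s : ℕ} {ν : ℕ → ℕ} {b : Fin (blockStart ν s) → Fin s}
    (hb : ∀ t j, b t = j ↔ blockStart ν j ≤ t ∧ (t : ℕ) < blockStart ν (j + 1))
    (w : Equiv.Perm (Fin (blockStart ν s))) :
    BlockIncreasing s (blockStart ν s) ν w ↔ ∀ t r, t < r → b t = b r → w t < w r := by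
  constructor
  · intro h t r htr hbl
    have h1 := (hb t _).1 rfl
    have h2 := (hb r _).1 hbl.symm
    exact h (b t) (b t).2 t r h1.1 htr h2.2
  · intro h j hj t r h1 htr h2
    refine h t r htr ?_
    rw [(hb t ⟨j, hj⟩).2 ⟨h1, htr.trans h2⟩, (hb r ⟨j, hj⟩).2 ⟨h1.trans htr.le, h2⟩]

theorem eq_sort_comp_inv {s : ℕ} {ν : ℕ → ℕ} {b : Fin (blockStart ν s) → Fin s}
    (hb : ∀ t j, b t = j ↔ blockStart ν j ≤ t ∧ (t : ℕ) < blockStart ν (j + 1))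
    {w : Equiv.Perm (Fin (blockStart ν s))} (hw : BlockIncreasing s (blockStart ν s) ν w) :
    w = Tuple.sort (b ∘ w.symm) := by
  rw [Tuple.eq_sort_iff]
  have hcomp : (b ∘ w.symm) ∘ w = b := by
    ext t
    simp
  rw [hcomp]
  refine ⟨block_monotone hb, fun t r htr h => ?_⟩
  exact (blockIncreasing_iff hb w).1 hw t r htr (by simpa using h)

theorem comp_sort_eq {s : ℕ} {ν : ℕ → ℕ} {b : Fin (blockStart ν s) → Fin s}
    (hb : ∀ t j, b t = j ↔ blockStart ν j ≤ t ∧ (t : ℕ) < blockStart ν (j + 1))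
    {f : Fin (blockStart ν s) → Fin s} (hf : letterCount f = fun j : Fin s => ν j) :
    f ∘ Tuple.sort f = b := by
  have hcard : ∀ j, Nonempty ({t // f t = j} ≃ {t // b t = j}) := by
    intro j
    have := congrFun (hf.trans (letterCount_block hb).symm) j
    rw [← Fintype.card_eq, Fintype.card_subtype, Fintype.card_subtype]
    exact this
  let e : Equiv.Perm (Fin (blockStart ν s)) := Equiv.ofFiberEquiv fun j => (hcard j).some
  have he : f = b ∘ e := by
    ext t
    exact congrArg Fin.val (Equiv.ofFiberEquiv_map (fun j => (hcard j).some) t).symm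
  have h1 : Monotone (b ∘ (e * Tuple.sort f : Equiv.Perm _)) := by
    have := Tuple.monotone_sort f
    nth_rewrite 1 [he] at this
    exact this
  have h2 : Monotone (b ∘ (1 : Equiv.Perm (Fin (blockStart ν s)))) := block_monotone hb
  have := Tuple.unique_monotone h1 h2
  nth_rewrite 1 [he]
  exact this

theorem blockIncreasing_sort {s : ℕ} {ν : ℕ → ℕ} {b : Fin (blockStart ν s) → Fin s}
    (hb : ∀ t j, b t = j ↔ blockStart ν j ≤ t ∧ (t : ℕ) < blockStart ν (j + 1))
    {f : Fin (blockStart ν s) → Fin s} (hf : letterCount f = fun j : Fin s => ν j) :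
    BlockIncreasing s (blockStart ν s) ν (Tuple.sort f) := by
  rw [blockIncreasing_iff hb, ← comp_sort_eq hb hf]
  exact fun t r htr h => ((Tuple.eq_sort_iff (f := f)).1 rfl).2 t r htr h

theorem wordInversions_comp_symm {s : ℕ} {ν : ℕ → ℕ} {b : Fin (blockStart ν s) → Fin s}
    (hb : ∀ t j, b t = j ↔ blockStart ν j ≤ t ∧ (t : ℕ) < blockStart ν (j + 1))
    {w : Equiv.Perm (Fin (blockStart ν s))} (hw : BlockIncreasing s (blockStart ν s) ν w) :
    inversions (blockStart ν s) w = wordInversions (b ∘ w.symm) := by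
  rw [blockIncreasing_iff hb] at hw
  refine Finset.card_nbij' (fun p => (w p.2, w p.1)) (fun p => (w.symm p.2, w.symm p.1)) ?_ ?_
    (by intro p; simp) (by intro p; simp)
  · rintro ⟨t, r⟩ h
    simp only [Finset.coe_filter, Finset.mem_univ, true_and, Set.mem_ofPred_eq,
      Function.comp_apply, Equiv.symm_apply_apply] at h ⊢
    refine ⟨h.2, (block_monotone hb h.1.le).lt_of_ne fun hbl => ?_⟩
    exact (hw t r h.1 hbl).not_gt h.2
  · rintro ⟨u, v⟩ h
    simp only [Finset.coe_filter, Finset.mem_univ, true_and, Set.mem_ofPred_eq,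
      Function.comp_apply, Equiv.apply_symm_apply] at h ⊢
    exact ⟨(block_monotone hb).reflect_lt h.2, h.1⟩

theorem letterCount_comp_perm {s n : ℕ} (f : Fin n → Fin s) (w : Equiv.Perm (Fin n)) :
    letterCount (f ∘ w) = letterCount f := by
  ext j
  simp only [letterCount, Finset.card_filter, Function.comp_apply]
  exact Equiv.sum_comp w fun t => if f t = j then 1 else 0

theorem sum_blockIncreasing_eq_signedWordCount (s : ℕ) (ν : ℕ → ℕ) :
    (∑ w : Equiv.Perm (Fin (blockStart ν s)), if BlockIncreasing s (blockStart ν s) ν w then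
      (-1 : ℤ) ^ inversions (blockStart ν s) w else 0) =
      signedWordCount s (blockStart ν s) fun j => ν j := by
  obtain ⟨b, hb⟩ := exists_block ν s
  rw [signedWordCount, ← Finset.sum_filter, ← Finset.sum_filter]
  refine Finset.sum_nbij' (fun w => b ∘ w.symm) (fun f => Tuple.sort f) ?_ ?_ ?_ ?_ ?_
  · intro w _
    rw [Finset.mem_filter, letterCount_comp_perm, letterCount_block hb]
    exact ⟨Finset.mem_univ _, rfl⟩
  · intro f hf
    exact Finset.mem_filter.2
      ⟨Finset.mem_univ _, blockIncreasing_sort hb (Finset.mem_filter.1 hf).2⟩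
  · intro w hw
    exact (eq_sort_comp_inv hb (Finset.mem_filter.1 hw).2).symm
  · intro f hf
    ext t
    simp [← comp_sort_eq hb (Finset.mem_filter.1 hf).2]
  · intro w hw
    rw [wordInversions_comp_symm hb (Finset.mem_filter.1 hw).2]

/-- Let `ν = (n₁, …, n_s)` be a sequence of positive integers with
`n = n₁ + ⋯ + n_s`, let `I(ν)` be the set of ν-block-increasing permutations of `{1, …, n}`,
and let `ν_o` be the number of indices `j` with `n_j` odd.  Then the signed count
`Σ_{w ∈ I(ν)} (−1)^{ℓ(w)}` equals `0` if `ν_o ≥ 2`, and equals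
`⌊n/2⌋!/(⌊n₁/2⌋!⋯⌊n_s/2⌋!)` if `ν_o ≤ 1`. -/
theorem signed_count_blockIncreasing
    (s n : ℕ) (ν : ℕ → ℕ) (hpos : ∀ j < s, 0 < ν j)
    (hn : n = blockStart ν s)
    (νo : ℕ) (hνo : νo = ((Finset.range s).filter fun j => Odd (ν j)).card) :
    (2 ≤ νo →
      (∑ w : Equiv.Perm (Fin n),
        if BlockIncreasing s n ν w then (-1 : ℤ) ^ inversions n w else 0) = 0) ∧
    (νo ≤ 1 →
      (∑ w : Equiv.Perm (Fin n),
        if BlockIncreasing s n ν w then (-1 : ℤ) ^ inversions n w else 0) =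
      ((Nat.factorial (n / 2) / ∏ j ∈ Finset.range s, Nat.factorial (ν j / 2) : ℕ) : ℤ)) := by
  subst hn
  have hcard : (oddLetters fun j : Fin s => ν j).card = νo := by
    rw [hνo, oddLetters, Finset.card_filter, Finset.card_filter, Finset.sum_range]
  rw [sum_blockIncreasing_eq_signedWordCount]
  obtain ⟨h2, h1⟩ := signedWordCount_spec (blockStart ν s) (fun j : Fin s => ν j)
    (Finset.sum_range ν).symm
  rw [hcard] at h1 h2
  refine ⟨h2, fun h => ?_⟩
  have hmul := h1 h
  rw [← Finset.prod_range fun j => (ν j / 2).factorial] at hmul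
  have hpos' : 0 < ∏ j ∈ Finset.range s, (ν j / 2).factorial :=
    Finset.prod_pos fun j _ => Nat.factorial_pos _
  rw [Int.natCast_div, ← hmul, Int.mul_ediv_cancel _ (by exact_mod_cast hpos'.ne')]
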